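/- Fix n, m, s ≥ 1, T ≥ 2, a doubly stochastic matrix W ∈ ℝ^{n×n} with nonnegative entries and σ := ‖W − (1/n)𝟏𝟏ᵀ‖ < 1, constraint vectors k_1,…,k_s ∈ ℝ^m with ‖k_q‖ ≤ K_I (K_I > 0), the polytope K = {y : k_qᵀy ≤ 0, q = 1,…,s} ⊆ B_R, and data with ‖h_i(t)‖² ≤ α_h, |z_i(t)| ≤ α_z for all i, t. Run DOLR-FIFC (as specified in the context) with η = 1/(c·s·K_I²·T^β) and π = 1/T^β for some β ∈ (0,1) and c > 1, from x_i(1) ∈ K, μ_i(1) = 0. Then for every node i and every y ∈ K: (a) ∑_{t=1}^T ∑_{j=1}^n θ_{j,t}(x_i(t)) − ∑_{t=1}^T ∑_{j=1}^n θ_{j,t}(y) ≤ 2nLC₃ + 2csnK_I²R²·T^β + (nL²(1 + 2nE)/(csK_I²) + n³L²E²/(c(c−1)sK_I²))·T^{1−β}; and (b) the cumulative constraints' violation satisfies ∑_{t=1}^T ∑_{i=1}^n ∑_{q=1}^s max{k_qᵀx_i(t), 0} ≤ (n/√(c−1))·(2csK_I R + L/K_I + 2√(csLR))·T^{1−β/2}.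 Here L = α_h R + √(α_h)·α_z, E = 3√n/(1−σ) + 4, C₃ = ∑_i ‖x_i(1) − x̄(1)‖ + √n·(σ/(1−σ))·∑_i ‖x_i(1)‖. -/

import Mathlib

open MeasureTheory ProbabilityTheory Finset
open scoped RealInnerProductSpace Pointwise

noncomputable section

/-- `ℝ^m` with the Euclidean norm. -/
abbrev Euc (m : ℕ) := EuclideanSpace ℝ (Fin m)

/-- The square loss `θ(y) = (1/2)(hᵀy − z)²`. -/
def sqLoss {m : ℕ} (h : Euc m) (z : ℝ) (y : Euc m) : ℝ := (1/2) * (⟪h, y⟫ - z)^2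

/-- The gradient `h (hᵀy − z)` of the square loss at `y`. -/
def sqLossGrad {m : ℕ} (h : Euc m) (z : ℝ) (y : Euc m) : Euc m := (⟪h, y⟫ - z) • h

/-- A matrix is doubly stochastic: nonnegative entries, every row and column sums to 1. -/
def DoublyStochastic {n : ℕ} (W : Matrix (Fin n) (Fin n) ℝ) : Prop :=
  (∀ i j, 0 ≤ W i j) ∧ (∀ i, ∑ j, W i j = 1) ∧ (∀ j, ∑ i, W i j = 1)

/-- Operator norm of a matrix, induced by the Euclidean norm on `ℝ^n`. -/
def matOpNorm {n : ℕ} (M : Matrix (Fin n) (Fin n) ℝ) : ℝ :=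
  ‖LinearMap.toContinuousLinearMap (Matrix.toEuclideanLin M)‖

/-- The averaging matrix `(1/n) 𝟏𝟏ᵀ`. -/
def avgMatrix (n : ℕ) : Matrix (Fin n) (Fin n) ℝ := Matrix.of fun _ _ => (n : ℝ)⁻¹

/-- Euclidean projection onto the closed ball of radius `R` centered at the origin:
`v` if `‖v‖ ≤ R`, and `R·v/‖v‖` otherwise. -/
def projBall {m : ℕ} (R : ℝ) (v : Euc m) : Euc m := if ‖v‖ ≤ R then v else (R / ‖v‖) • v

/-- The subgradient `d_q(x)` of `y ↦ [k_qᵀy]₊` at `x`: equal to `k_q` if `k_qᵀx > 0`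
and to `0` otherwise. -/
def hingeGrad {m : ℕ} (k x : Euc m) : Euc m := if 0 < ⟪k, x⟫ then k else 0

/-- A polyhedral cone contained in a ball is trivial. -/
lemma eq_zero_of_mem_cone_subset_closedBall {m : ℕ} {ι : Type*} {k : ι → Euc m} {R : ℝ}
    (hKR : {y : Euc m | ∀ q, ⟪k q, y⟫ ≤ 0} ⊆ Metric.closedBall (0 : Euc m) R)
    {y : Euc m} (hy : ∀ q, ⟪k q, y⟫ ≤ 0) : y = 0 := by
  by_contra hne
  have hpos : 0 < ‖y‖ := norm_pos_iff.mpr hne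
  have hR : 0 ≤ R := by
    have h0 : (0 : Euc m) ∈ Metric.closedBall (0 : Euc m) R := hKR (by simp)
    simpa using h0
  have hmem : ((R + 1) / ‖y‖) • y ∈ Metric.closedBall (0 : Euc m) R := by
    apply hKR
    intro q
    rw [inner_smul_right]
    exact mul_nonpos_of_nonneg_of_nonpos (by positivity) (hy q)
  rw [mem_closedBall_zero_iff, norm_smul, Real.norm_of_nonneg (by positivity),
    div_mul_cancel₀ _ hpos.ne'] at hmem
  linarith

lemma norm_projBall_le_radius {m : ℕ} {R : ℝ} (hR : 0 ≤ R) (v : Euc m) :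
    ‖projBall R v‖ ≤ R := by
  unfold projBall
  split_ifs with hv
  · exact hv
  · have hpos : 0 < ‖v‖ := by linarith
    rw [norm_smul, Real.norm_of_nonneg (by positivity), div_mul_cancel₀ _ hpos.ne']

lemma norm_projBall_le {m : ℕ} {R : ℝ} (hR : 0 ≤ R) (v : Euc m) :
    ‖projBall R v‖ ≤ ‖v‖ := by
  by_cases hv : ‖v‖ ≤ R
  · simp [projBall, hv]
  · exact (norm_projBall_le_radius hR v).trans (not_le.mp hv).le

/-- The projection of `v` onto the ball is at least as close to `v` as any point of the ball. -/
lemma norm_projBall_sub_le {m : ℕ} {R : ℝ} (hR : 0 ≤ R) (v w : Euc m) (hw : ‖w‖ ≤ R) :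
    ‖projBall R v - v‖ ≤ ‖v - w‖ := by
  unfold projBall
  split_ifs with hv
  · simp
  · have hpos : 0 < ‖v‖ := by linarith
    have hrw : (R / ‖v‖) • v - v = -((1 - R / ‖v‖) • v) := by module
    have hle : R / ‖v‖ ≤ 1 := (div_le_one hpos).mpr (not_le.mp hv).le
    rw [hrw, norm_neg, norm_smul, Real.norm_of_nonneg (by linarith), sub_mul, one_mul,
      div_mul_cancel₀ _ hpos.ne']
    linarith [norm_sub_norm_le v w]

/-- Summed Jensen inequality for averaging with a doubly stochastic matrix. -/
lemma DoublyStochastic.sum_norm_sq_le {n m : ℕ} {W : Matrix (Fin n) (Fin n) ℝ}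
    (hW : DoublyStochastic W) (v : Fin n → Euc m) :
    ∑ i, ‖∑ j, W i j • v j‖ ^ 2 ≤ ∑ j, ‖v j‖ ^ 2 := by
  obtain ⟨h0, hr, hc⟩ := hW
  have hi : ∀ i, ‖∑ j, W i j • v j‖ ^ 2 ≤ ∑ j, W i j * ‖v j‖ ^ 2 := by
    intro i
    have h1 : ‖∑ j, W i j • v j‖ ≤ ∑ j, W i j * ‖v j‖ := by
      refine (norm_sum_le _ _).trans (Finset.sum_le_sum fun j _ => ?_)
      rw [norm_smul, Real.norm_of_nonneg (h0 i j)]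
    refine (pow_le_pow_left₀ (norm_nonneg _) h1 2).trans ?_
    exact Real.pow_arith_mean_le_arith_mean_pow Finset.univ _ _ (fun j _ => h0 i j) (hr i)
      (fun j _ => norm_nonneg _) 2
  refine (Finset.sum_le_sum fun i _ => hi i).trans (le_of_eq ?_)
  rw [Finset.sum_comm]
  refine Finset.sum_congr rfl fun j _ => ?_
  rw [← Finset.sum_mul, hc j, one_mul]

lemma DoublyStochastic.norm_sum_smul_le {n m : ℕ} {W : Matrix (Fin n) (Fin n) ℝ}
    (hW : DoublyStochastic W) (v : Fin n → Euc m) {R : ℝ} (hv : ∀ j, ‖v j‖ ≤ R) (i : Fin n) :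
    ‖∑ j, W i j • v j‖ ≤ R := by
  calc ‖∑ j, W i j • v j‖ ≤ ∑ j, W i j * R := by
        refine (norm_sum_le _ _).trans (Finset.sum_le_sum fun j _ => ?_)
        rw [norm_smul, Real.norm_of_nonneg (hW.1 i j)]
        exact mul_le_mul_of_nonneg_left (hv j) (hW.1 i j)
    _ = R := by rw [← Finset.sum_mul, hW.2.1 i, one_mul]

/-- Total deviation of a projected averaging step from plain averaging. -/
lemma DoublyStochastic.sum_norm_projBall_step_le {n m : ℕ} {W : Matrix (Fin n) (Fin n) ℝ}
    (hW : DoublyStochastic W) {R : ℝ} (hR : 0 ≤ R) {x x' u : Fin n → Euc m}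
    (hx : ∀ j, ‖x j‖ ≤ R) (hx' : ∀ i, x' i = projBall R (∑ j, W i j • (x j - u j))) :
    ∑ i, ‖x' i - ∑ j, W i j • x j‖ ≤ ∑ j, 2 * ‖u j‖ := by
  have hi : ∀ i, ‖x' i - ∑ j, W i j • x j‖ ≤ ∑ j, W i j * (2 * ‖u j‖) := by
    intro i
    set v := ∑ j, W i j • (x j - u j) with hv
    have h1 := norm_projBall_sub_le hR v _ (hW.norm_sum_smul_le x hx i)
    have h2 := norm_add_le (projBall R v - v) (v - ∑ j, W i j • x j)
    rw [sub_add_sub_cancel, ← hx' i] at h2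
    have h3 : ‖v - ∑ j, W i j • x j‖ ≤ ∑ j, W i j * ‖u j‖ := by
      rw [hv, ← Finset.sum_sub_distrib]
      refine (norm_sum_le _ _).trans (Finset.sum_le_sum fun j _ => le_of_eq ?_)
      rw [← smul_sub, sub_sub_cancel_left, norm_smul, norm_neg, Real.norm_of_nonneg (hW.1 i j)]
    rw [hx' i] at h2 ⊢
    have h4 : ∑ j, W i j * (2 * ‖u j‖) = 2 * ∑ j, W i j * ‖u j‖ := by
      rw [Finset.mul_sum]
      exact Finset.sum_congr rfl fun j _ => by ring
    rw [h4]
    linarith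
  refine (Finset.sum_le_sum fun i _ => hi i).trans (le_of_eq ?_)
  rw [Finset.sum_comm]
  refine Finset.sum_congr rfl fun j _ => ?_
  rw [← Finset.sum_mul, hW.2.2 j, one_mul]

/-- The operator norm on `ℝ^n` also controls the action on families of vectors. -/
lemma sum_norm_sq_matrix_smul_le {n m : ℕ} (M : Matrix (Fin n) (Fin n) ℝ)
    (v : Fin n → Euc m) :
    ∑ i, ‖∑ j, M i j • v j‖ ^ 2 ≤ matOpNorm M ^ 2 * ∑ j, ‖v j‖ ^ 2 := by
  have key : ∀ a : Fin m, ∑ i, (∑ j, M i j * v j a) ^ 2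
      ≤ matOpNorm M ^ 2 * ∑ j, (v j a) ^ 2 := by
    intro a
    have h1 := ContinuousLinearMap.le_opNorm
      (LinearMap.toContinuousLinearMap (Matrix.toEuclideanLin M)) (WithLp.toLp 2 fun j => v j a)
    have h2 := pow_le_pow_left₀ (norm_nonneg _) h1 2
    rw [mul_pow, EuclideanSpace.norm_sq_eq, EuclideanSpace.norm_sq_eq] at h2
    simpa [matOpNorm, Matrix.mulVec, dotProduct] using h2
  calc ∑ i, ‖∑ j, M i j • v j‖ ^ 2 = ∑ a, ∑ i, (∑ j, M i j * v j a) ^ 2 := by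
        rw [Finset.sum_comm]
        simp [EuclideanSpace.norm_sq_eq]
    _ ≤ ∑ a, matOpNorm M ^ 2 * ∑ j, (v j a) ^ 2 := Finset.sum_le_sum fun a _ => key a
    _ = matOpNorm M ^ 2 * ∑ j, ‖v j‖ ^ 2 := by
        rw [← Finset.mul_sum, Finset.sum_comm]
        simp [EuclideanSpace.norm_sq_eq]

/-- The arithmetic mean of a family of vectors. -/
def vecMean {n m : ℕ} (x : Fin n → Euc m) : Euc m := (n : ℝ)⁻¹ • ∑ l, x l

/-- The `ℓ²` distance of a family of vectors to consensus. -/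
def dispersion {n m : ℕ} (x : Fin n → Euc m) : ℝ := √(∑ i, ‖x i - vecMean x‖ ^ 2)

lemma norm_sub_vecMean_le_dispersion {n m : ℕ} (x : Fin n → Euc m) (i : Fin n) :
    ‖x i - vecMean x‖ ≤ dispersion x := by
  refine Real.le_sqrt_of_sq_le ?_
  exact Finset.single_le_sum (f := fun i => ‖x i - vecMean x‖ ^ 2)
    (fun _ _ => sq_nonneg _) (Finset.mem_univ i)

lemma norm_sub_le_two_mul_dispersion {n m : ℕ} (x : Fin n → Euc m) (i j : Fin n) :
    ‖x i - x j‖ ≤ 2 * dispersion x := by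
  have h1 := norm_sub_vecMean_le_dispersion x i
  have h2 := norm_sub_vecMean_le_dispersion x j
  have h3 := norm_sub_le (x i - vecMean x) (x j - vecMean x)
  rw [sub_sub_sub_cancel_right] at h3
  linarith

lemma sum_sub_vecMean {n m : ℕ} (hn : n ≠ 0) (x : Fin n → Euc m) :
    ∑ i, (x i - vecMean x) = 0 := by
  have hn' : (n : ℝ) ≠ 0 := Nat.cast_ne_zero.mpr hn
  rw [Finset.sum_sub_distrib, Finset.sum_const, Finset.card_univ, Fintype.card_fin,
    ← Nat.cast_smul_eq_nsmul ℝ, vecMean, smul_smul, mul_inv_cancel₀ hn', one_smul, sub_self]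

lemma dispersion_le_sum_norm {n m : ℕ} (hn : n ≠ 0) (e : Fin n → Euc m) :
    dispersion e ≤ ∑ i, ‖e i‖ := by
  have h1 : ∑ i, ‖e i - vecMean e‖ ^ 2 ≤ ∑ i, ‖e i‖ ^ 2 := by
    have h2 : ∀ i, ‖e i‖ ^ 2 = ‖e i - vecMean e‖ ^ 2 + 2 * ⟪e i - vecMean e, vecMean e⟫
        + ‖vecMean e‖ ^ 2 := by
      intro i
      rw [← norm_add_sq_real, sub_add_cancel]
    simp_rw [h2, Finset.sum_add_distrib, ← Finset.mul_sum, ← sum_inner]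
    rw [sum_sub_vecMean hn, inner_zero_left]
    have : 0 ≤ ∑ _i : Fin n, ‖vecMean e‖ ^ 2 := by positivity
    linarith
  refine (Real.sqrt_le_sqrt h1).trans ?_
  rw [Real.sqrt_le_left (by positivity)]
  exact Finset.sum_sq_le_sq_sum_of_nonneg fun i _ => norm_nonneg _

/-- Contraction of the dispersion under a perturbed doubly stochastic averaging step. -/
lemma dispersion_step {n m : ℕ} (hn : n ≠ 0) {W : Matrix (Fin n) (Fin n) ℝ}
    (hW : DoublyStochastic W) {x x' e : Fin n → Euc m}
    (hx : ∀ i, x' i = ∑ j, W i j • x j + e i) :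
    dispersion x' ≤ matOpNorm (W - avgMatrix n) * dispersion x + ∑ i, ‖e i‖ := by
  have hmean : vecMean x' = vecMean x + vecMean e := by
    unfold vecMean
    rw [← smul_add]
    congr 1
    simp_rw [hx, Finset.sum_add_distrib]
    congr 1
    rw [Finset.sum_comm]
    refine Finset.sum_congr rfl fun j _ => ?_
    rw [← Finset.sum_smul, hW.2.2 j, one_smul]
  have hdev : ∀ i, x' i - vecMean x'
      = ∑ j, (W - avgMatrix n) i j • (x j - vecMean x) + (e i - vecMean e) := by
    intro i
    have h1 : ∑ j, (W - avgMatrix n) i j • (x j - vecMean x)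
        = ∑ j, W i j • x j - vecMean x := by
      have h2 : ∑ j, avgMatrix n i j • (x j - vecMean x) = 0 := by
        simp only [avgMatrix, Matrix.of_apply]
        rw [← Finset.smul_sum, sum_sub_vecMean hn, smul_zero]
      have h3 : ∑ j, W i j • (x j - vecMean x) = ∑ j, W i j • x j - vecMean x := by
        simp_rw [smul_sub, Finset.sum_sub_distrib]
        rw [← Finset.sum_smul, hW.2.1 i, one_smul]
      simp_rw [Matrix.sub_apply, sub_smul, Finset.sum_sub_distrib]
      rw [h2, h3, sub_zero]
    rw [h1, hx, hmean]
    abel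
  have hnorm : ∀ v : Fin n → Euc m,
      √(∑ i, ‖v i‖ ^ 2) = ‖(WithLp.toLp 2 v : PiLp 2 fun _ : Fin n => Euc m)‖ := by
    intro v
    rw [PiLp.norm_eq_of_L2]
  have hop : 0 ≤ matOpNorm (W - avgMatrix n) := norm_nonneg _
  calc dispersion x'
      = ‖(WithLp.toLp 2 (fun i => ∑ j, (W - avgMatrix n) i j • (x j - vecMean x)) +
          WithLp.toLp 2 (fun i => e i - vecMean e) : PiLp 2 fun _ : Fin n => Euc m)‖ := by
        rw [← WithLp.toLp_add, ← hnorm]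
        simp only [dispersion, hdev, Pi.add_apply]
    _ ≤ √(∑ i, ‖∑ j, (W - avgMatrix n) i j • (x j - vecMean x)‖ ^ 2) + dispersion e := by
        refine (norm_add_le _ _).trans (le_of_eq ?_)
        rw [← hnorm, ← hnorm, dispersion]
    _ ≤ matOpNorm (W - avgMatrix n) * dispersion x + ∑ i, ‖e i‖ := by
        refine add_le_add ?_ (dispersion_le_sum_norm hn e)
        refine (Real.sqrt_le_sqrt (sum_norm_sq_matrix_smul_le _ _)).trans (le_of_eq ?_)
        rw [Real.sqrt_mul (sq_nonneg _), Real.sqrt_sq hop, dispersion]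

lemma sum_Icc_le_of_telescoping {V a : ℕ → ℝ} {T : ℕ}
    (hstep : ∀ t ∈ Finset.Icc 1 T, V (t + 1) ≤ V t - a t) :
    ∑ t ∈ Finset.Icc 1 T, a t ≤ V 1 - V (T + 1) := by
  induction T with
  | zero => simp
  | succ T ih =>
    have h1 := ih fun t ht => hstep t (by simp only [Finset.mem_Icc] at ht ⊢; omega)
    have h2 := hstep (T + 1) (by simp)
    rw [Finset.sum_Icc_succ_top (by omega)]
    linarith

lemma norm_sqLossGrad_le {m : ℕ} {h x : Euc m} {z αh αz R : ℝ} (hh : ‖h‖ ^ 2 ≤ αh)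
    (hz : |z| ≤ αz) (hx : ‖x‖ ≤ R) :
    ‖sqLossGrad h z x‖ ≤ αh * R + √αh * αz := by
  have hh' : ‖h‖ ≤ √αh := Real.le_sqrt_of_sq_le hh
  have hα : 0 ≤ αh := (sq_nonneg _).trans hh
  have hR : 0 ≤ R := (norm_nonneg _).trans hx
  have hz0 : 0 ≤ αz := (abs_nonneg _).trans hz
  have h1 : |⟪h, x⟫ - z| ≤ √αh * R + αz := by
    refine (abs_sub _ _).trans (add_le_add ?_ hz)
    exact (abs_real_inner_le_norm h x).trans (by gcongr)
  rw [sqLossGrad, norm_smul, Real.norm_eq_abs]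
  calc |⟪h, x⟫ - z| * ‖h‖ ≤ (√αh * R + αz) * √αh := by gcongr
    _ = √αh ^ 2 * R + √αh * αz := by ring
    _ = αh * R + √αh * αz := by rw [Real.sq_sqrt hα]

/-- The square loss is Lipschitz on the ball of radius `R`. -/
lemma sqLoss_sub_le {m : ℕ} {h x y : Euc m} {z αh αz R : ℝ} (hh : ‖h‖ ^ 2 ≤ αh)
    (hz : |z| ≤ αz) (hx : ‖x‖ ≤ R) (hy : ‖y‖ ≤ R) :
    sqLoss h z x - sqLoss h z y ≤ (αh * R + √αh * αz) * ‖x - y‖ := by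
  have h1 : sqLoss h z x - sqLoss h z y
      = (1 / 2) * ⟪sqLossGrad h z x + sqLossGrad h z y, x - y⟫ := by
    simp only [sqLoss, sqLossGrad, inner_add_left, real_inner_smul_left, inner_sub_right]
    ring
  have h2 := real_inner_le_norm (sqLossGrad h z x + sqLossGrad h z y) (x - y)
  have h3 := norm_add_le (sqLossGrad h z x) (sqLossGrad h z y)
  have h4 := norm_sqLossGrad_le hh hz hx
  have h5 := norm_sqLossGrad_le hh hz hy
  have h6 : ‖sqLossGrad h z x + sqLossGrad h z y‖ * ‖x - y‖
      ≤ (2 * (αh * R + √αh * αz)) * ‖x - y‖ :=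
    mul_le_mul_of_nonneg_right (by linarith) (norm_nonneg _)
  rw [h1]
  linarith

lemma sqLoss_sub_zero_le {m : ℕ} (h x : Euc m) (z : ℝ) :
    sqLoss h z x - sqLoss h z 0 ≤ ⟪sqLossGrad h z x, x⟫ := by
  simp only [sqLoss, sqLossGrad, real_inner_smul_left, inner_zero_right]
  nlinarith [sq_nonneg ⟪h, x⟫]

/-- Half the gradient of the quadratic penalty `∑ q, [k_qᵀx]₊²`. -/
def hingePenaltyGrad {m s : ℕ} (k : Fin s → Euc m) (x : Euc m) : Euc m :=
  ∑ q, max ⟪k q, x⟫ 0 • k q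

/-- The length `√(∑ q, [k_qᵀx]₊²)` of the constraint residual at `x`. -/
def hingeResidual {m s : ℕ} (k : Fin s → Euc m) (x : Euc m) : ℝ :=
  √(∑ q, max ⟪k q, x⟫ 0 ^ 2)

lemma sum_smul_hingeGrad {m s : ℕ} (k : Fin s → Euc m) (x : Euc m) (a : ℝ) :
    ∑ q, (a * max ⟪k q, x⟫ 0) • hingeGrad (k q) x = a • hingePenaltyGrad k x := by
  rw [hingePenaltyGrad, Finset.smul_sum]
  refine Finset.sum_congr rfl fun q _ => ?_
  unfold hingeGrad
  split_ifs with hq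
  · rw [smul_smul]
  · simp [max_eq_right (not_lt.mp hq)]

lemma sq_hingeResidual {m s : ℕ} (k : Fin s → Euc m) (x : Euc m) :
    hingeResidual k x ^ 2 = ∑ q, max ⟪k q, x⟫ 0 ^ 2 :=
  Real.sq_sqrt (Finset.sum_nonneg fun _ _ => sq_nonneg _)

lemma inner_hingePenaltyGrad {m s : ℕ} (k : Fin s → Euc m) (x : Euc m) :
    ⟪x, hingePenaltyGrad k x⟫ = hingeResidual k x ^ 2 := by
  rw [sq_hingeResidual, hingePenaltyGrad, inner_sum]
  refine Finset.sum_congr rfl fun q _ => ?_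
  rw [inner_smul_right, real_inner_comm (k q) x]
  rcases le_total ⟪k q, x⟫ 0 with hq | hq
  · rw [max_eq_right hq, zero_mul, zero_pow two_ne_zero]
  · rw [max_eq_left hq, sq]

lemma sum_hinge_le {m s : ℕ} (k : Fin s → Euc m) (x : Euc m) :
    ∑ q, max ⟪k q, x⟫ 0 ≤ √s * hingeResidual k x := by
  rw [hingeResidual, ← Real.sqrt_mul (Nat.cast_nonneg s)]
  refine Real.le_sqrt_of_sq_le ?_
  simpa using sq_sum_le_card_mul_sum_sq (s := Finset.univ) (f := fun q => max ⟪k q, x⟫ 0)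

lemma norm_hingePenaltyGrad_le {m s : ℕ} {k : Fin s → Euc m} {K : ℝ} (hK : 0 ≤ K)
    (hk : ∀ q, ‖k q‖ ≤ K) (x : Euc m) :
    ‖hingePenaltyGrad k x‖ ≤ K * (√s * hingeResidual k x) := by
  calc ‖hingePenaltyGrad k x‖ ≤ ∑ q, max ⟪k q, x⟫ 0 * K := by
        refine (norm_sum_le _ _).trans (Finset.sum_le_sum fun q _ => ?_)
        rw [norm_smul, Real.norm_of_nonneg (le_max_right _ _)]
        exact mul_le_mul_of_nonneg_left (hk q) (le_max_right _ _)
    _ = K * ∑ q, max ⟪k q, x⟫ 0 := by rw [← Finset.sum_mul, mul_comm]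
    _ ≤ _ := mul_le_mul_of_nonneg_left (sum_hinge_le k x) hK

/-- Energy decrease of a penalized gradient step. -/
lemma norm_sub_step_sq_le {E : Type*} [NormedAddCommGroup E] [InnerProductSpace ℝ E]
    {x g p : E} {η c L r : ℝ} (hη : 0 ≤ η) (hg : ‖g‖ ≤ L) (hp : ‖p‖ ≤ r)
    (hxp : ⟪x, p⟫ = c * r ^ 2) :
    ‖x - (η • g + p)‖ ^ 2
      ≤ ‖x‖ ^ 2 - (2 * η * ⟪g, x⟫ - 2 * η ^ 2 * L ^ 2 + 2 * (c - 1) * r ^ 2) := by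
  have h1 : ‖η • g + p‖ ^ 2 ≤ 2 * (η * L) ^ 2 + 2 * r ^ 2 := by
    have h2 : ‖η • g + p‖ ≤ η * L + r := by
      refine (norm_add_le _ _).trans (add_le_add ?_ hp)
      rw [norm_smul, Real.norm_of_nonneg hη]
      exact mul_le_mul_of_nonneg_left hg hη
    nlinarith [pow_le_pow_left₀ (norm_nonneg _) h2 2, sq_nonneg (η * L - r)]
  rw [norm_sub_sq_real, inner_add_right, inner_smul_right, hxp, real_inner_comm]
  linarith

/-- Constants of the regret bound, from summed energy and consensus estimates. -/
lemma regret_constant_bound {ι : Type*} (A : Finset ι) (r : ι → ℝ)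
    {η c L a : ℝ} (hη : 0 < η) (hc : 1 < c) :
    A.card * η * L ^ 2 - (c - 1) / η * ∑ p ∈ A, r p ^ 2 + L * a * ∑ p ∈ A, (η * L + r p)
      ≤ A.card * η * L ^ 2 * (1 + a + a ^ 2 / (4 * (c - 1))) := by
  have hc' : 0 < c - 1 := by linarith
  have h1 : ∀ p ∈ A, L * a * (η * L + r p) - (c - 1) / η * r p ^ 2
      ≤ η * L ^ 2 * (a + a ^ 2 / (4 * (c - 1))) := by
    intro p _
    have h2 : η * L ^ 2 * (a + a ^ 2 / (4 * (c - 1)))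
        - (L * a * (η * L + r p) - (c - 1) / η * r p ^ 2)
        = (η * L * a - 2 * (c - 1) * r p) ^ 2 / (4 * (c - 1) * η) := by
      field_simp
      ring
    have h3 : 0 ≤ (η * L * a - 2 * (c - 1) * r p) ^ 2 / (4 * (c - 1) * η) := by positivity
    linarith
  have h4 := Finset.sum_le_sum h1
  rw [Finset.sum_sub_distrib, ← Finset.mul_sum, ← Finset.mul_sum, Finset.sum_const,
    nsmul_eq_mul] at h4
  linarith

/-- Cauchy–Schwarz passage from a bound on the sum of squares to a bound on the sum. -/
lemma sum_le_of_sum_sq_le {ι : Type*} (A : Finset ι) (r : ι → ℝ) {a b d : ℝ} (ha : 0 ≤ a)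
    (hb : 0 ≤ b) (hd : 0 < d) (hr : ∑ p ∈ A, r p ^ 2 ≤ A.card * (a ^ 2 + b) / d) :
    ∑ p ∈ A, r p ≤ A.card / √d * (a + √b) := by
  refine le_of_abs_le (abs_le_of_sq_le_sq ?_ (by positivity))
  have h1 := sq_sum_le_card_mul_sum_sq (s := A) (f := r)
  have h2 := mul_le_mul_of_nonneg_left hr (Nat.cast_nonneg (α := ℝ) A.card)
  have h3 : a ^ 2 + b ≤ (a + √b) ^ 2 := by
    have h4 : 0 ≤ a * √b := by positivity
    linarith [Real.sq_sqrt hb, (by ring : (a + √b) ^ 2 = a ^ 2 + 2 * (a * √b) + √b ^ 2)]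
  have h5 : A.card * (A.card * (a ^ 2 + b) / d) ≤ A.card * (A.card * (a + √b) ^ 2 / d) := by
    gcongr
  refine (h1.trans h2).trans (h5.trans (le_of_eq ?_))
  rw [mul_pow, div_pow, Real.sq_sqrt hd.le]
  ring

lemma stepSize_mul_horizon {T K s c β η : ℝ} (hT : 0 < T)
    (hη : η = 1 / (c * s * K ^ 2 * T ^ β)) :
    η * T = 1 / (c * s * K ^ 2) * T ^ (1 - β) := by
  rw [hη, Real.rpow_sub hT, Real.rpow_one]
  field_simp

/-- Constants of the constraint violation bound for the prescribed step size. -/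
lemma violation_constant_bound {T : ℕ} {K s c β η L R : ℝ} (hT : 2 ≤ T) (hs : 0 < s)
    (hK : 0 < K) (hβ : 0 < β) (hc : 0 < c) (hR : 0 ≤ R) (hL : 0 ≤ L)
    (hη : η = 1 / (c * s * K ^ 2 * (T : ℝ) ^ β)) :
    c * s * K * (T * (η * L + √(η * L * R)))
      ≤ (2 * c * s * K * R + L / K + 2 * √(c * s * L * R)) * (T : ℝ) ^ (1 - β / 2) := by
  have hTpos : (0 : ℝ) < T := by exact_mod_cast (by omega : 0 < T)
  have hpow : (T : ℝ) ^ (1 - β) ≤ (T : ℝ) ^ (1 - β / 2) :=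
    Real.rpow_le_rpow_of_exponent_le (by exact_mod_cast (by omega : 1 ≤ T)) (by linarith)
  have hterm1 : c * s * K * (T * (η * L)) ≤ L / K * (T : ℝ) ^ (1 - β / 2) := by
    calc c * s * K * (T * (η * L)) = η * T * (c * s * K * L) := by ring
      _ = L / K * (T : ℝ) ^ (1 - β) := by
          rw [stepSize_mul_horizon hTpos hη]
          field_simp
      _ ≤ _ := by gcongr
  have hterm2 : c * s * K * (T * √(η * L * R)) = √(c * s * L * R) * (T : ℝ) ^ (1 - β / 2) := by
    have hP : 0 < (T : ℝ) ^ (β / 2) := Real.rpow_pos_of_pos hTpos _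
    have h1 : η * L * R = c * s * L * R * (1 / (c * s * K * (T : ℝ) ^ (β / 2))) ^ 2 := by
      have h2 : (T : ℝ) ^ β = ((T : ℝ) ^ (β / 2)) ^ 2 := by
        rw [← Real.rpow_natCast, ← Real.rpow_mul hTpos.le]
        norm_num
      rw [hη, h2]
      field_simp
    rw [h1, Real.sqrt_mul (by positivity), Real.sqrt_sq (by positivity),
      Real.rpow_sub hTpos, Real.rpow_one]
    generalize √(c * s * L * R) = w
    field_simp
  have h3 : 0 ≤ (2 * c * s * K * R + √(c * s * L * R)) * (T : ℝ) ^ (1 - β / 2) := by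
    positivity
  linarith

/-- Theorem 4. Regret and cumulative constraints' violation bounds
for DOLR-FIFC with `η = 1/(csK_I²T^β)` and `π = 1/T^β`. -/
theorem dolr_fifc_regret_and_violation_bound
    {n m s T : ℕ} (hn : 1 ≤ n) (hm : 1 ≤ m) (hs : 1 ≤ s) (hT : 2 ≤ T)
    (W : Matrix (Fin n) (Fin n) ℝ) (hW : DoublyStochastic W)
    (σ : ℝ) (hσdef : σ = matOpNorm (W - avgMatrix n)) (hσ : σ < 1)
    (k : Fin s → Euc m) (KI : ℝ) (hKI : 0 < KI) (hk : ∀ q, ‖k q‖ ≤ KI)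
    (R : ℝ)
    (hKR : {y : Euc m | ∀ q, ⟪k q, y⟫ ≤ 0} ⊆ Metric.closedBall (0 : Euc m) R)
    (h : Fin n → ℕ → Euc m) (z : Fin n → ℕ → ℝ) (αh αz : ℝ)
    (hh : ∀ i, ∀ t ∈ Finset.Icc 1 T, ‖h i t‖ ^ 2 ≤ αh)
    (hz : ∀ i, ∀ t ∈ Finset.Icc 1 T, |z i t| ≤ αz)
    (β : ℝ) (hβ0 : 0 < β) (hβ1 : β < 1) (c : ℝ) (hc : 1 < c)
    (η π : ℝ)
    (hη : η = 1 / (c * s * KI ^ 2 * (T : ℝ) ^ β))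
    (hπ : π = 1 / (T : ℝ) ^ β)
    (x : Fin n → ℕ → Euc m) (lam : Fin n → ℕ → Fin s → ℝ)
    (hx1 : ∀ i, ∀ q, ⟪k q, x i 1⟫ ≤ 0)
    (hlam1 : ∀ i q, lam i 1 q = 0)
    (hxrec : ∀ i, ∀ t ∈ Finset.Icc 1 T, x i (t + 1) =
      projBall R (∑ j, W i j • (x j t - η • (sqLossGrad (h j t) (z j t) (x j t)
        + ∑ q, lam j t q • hingeGrad (k q) (x j t)))))
    (hlamrec : ∀ i, ∀ t ∈ Finset.Icc 1 T, ∀ q,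
      lam i (t + 1) q = max ⟪k q, x i (t + 1)⟫ 0 / π)
    (L Ec C₃ : ℝ)
    (hL : L = αh * R + Real.sqrt αh * αz)
    (hEc : Ec = 3 * Real.sqrt n / (1 - σ) + 4)
    (hC₃ : C₃ = (∑ i, ‖x i 1 - (n : ℝ)⁻¹ • ∑ l, x l 1‖)
      + Real.sqrt n * (σ / (1 - σ)) * ∑ i, ‖x i 1‖) :
    (∀ i : Fin n, ∀ y : Euc m, (∀ q, ⟪k q, y⟫ ≤ 0) →
      (∑ t ∈ Finset.Icc 1 T, ∑ j, sqLoss (h j t) (z j t) (x i t))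
        - (∑ t ∈ Finset.Icc 1 T, ∑ j, sqLoss (h j t) (z j t) y)
        ≤ 2 * n * L * C₃ + 2 * c * s * n * KI ^ 2 * R ^ 2 * (T : ℝ) ^ β
          + (n * L ^ 2 * (1 + 2 * n * Ec) / (c * s * KI ^ 2)
            + n ^ 3 * L ^ 2 * Ec ^ 2 / (c * (c - 1) * s * KI ^ 2)) * (T : ℝ) ^ (1 - β))
    ∧ ∑ t ∈ Finset.Icc 1 T, ∑ i, ∑ q, max ⟪k q, x i t⟫ 0
        ≤ (n / Real.sqrt (c - 1)) * (2 * c * s * KI * R + L / KI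
            + 2 * Real.sqrt (c * s * L * R)) * (T : ℝ) ^ (1 - β / 2) := by
  have hn0 : n ≠ 0 := by omega
  have hnpos : (0 : ℝ) < n := by exact_mod_cast hn
  have hspos : (0 : ℝ) < s := by exact_mod_cast hs
  have hTpos : (0 : ℝ) < T := by exact_mod_cast (by omega : 0 < T)
  have h1mem : (1 : ℕ) ∈ Finset.Icc 1 T := by simp only [Finset.mem_Icc]; omega
  have hα0 : 0 ≤ αh := (sq_nonneg _).trans (hh ⟨0, hn⟩ 1 h1mem)
  have hz0 : 0 ≤ αz := (abs_nonneg _).trans (hz ⟨0, hn⟩ 1 h1mem)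
  have hR : 0 ≤ R := by
    have h0 : (0 : Euc m) ∈ Metric.closedBall (0 : Euc m) R := hKR (by simp)
    simpa using h0
  have hL0 : 0 ≤ L := by rw [hL]; positivity
  have hσ0 : 0 ≤ σ := hσdef ▸ norm_nonneg _
  have hσ1 : 0 < 1 - σ := by linarith
  have hc1 : 0 < c - 1 := by linarith
  have hc0 : 0 < c := by linarith
  have hPpos : 0 < (T : ℝ) ^ β := Real.rpow_pos_of_pos hTpos β
  have hηpos : 0 < η := by rw [hη]; positivity
  have hηP : η * (T : ℝ) ^ β = 1 / (c * s * KI ^ 2) := by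
    rw [hη]; field_simp
  have hss : √(s : ℝ) ^ 2 = s := Real.sq_sqrt hspos.le
  have hsspos : 0 < √(s : ℝ) := Real.sqrt_pos.mpr hspos
  have hx1z : ∀ i, x i 1 = 0 := fun i => eq_zero_of_mem_cone_subset_closedBall hKR (hx1 i)
  have hlam : ∀ j, ∀ t ∈ Finset.Icc 1 T, ∀ q,
      lam j t q = (T : ℝ) ^ β * max ⟪k q, x j t⟫ 0 := by
    intro j t ht q
    rw [Finset.mem_Icc] at ht
    obtain rfl | ⟨t', rfl, ht'⟩ : t = 1 ∨ ∃ t', t = t' + 1 ∧ t' ∈ Finset.Icc 1 T := by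
      rcases Nat.lt_or_ge 1 t with h1 | h1
      · exact Or.inr ⟨t - 1, by omega, by rw [Finset.mem_Icc]; omega⟩
      · exact Or.inl (by omega)
    · rw [hlam1, max_eq_right (hx1 j q), mul_zero]
    · rw [hlamrec j t' ht' q, hπ]
      field_simp
  have hxR : ∀ i, ∀ t ∈ Finset.Icc 1 T, ‖x i t‖ ≤ R := by
    intro i t ht
    rw [Finset.mem_Icc] at ht
    rcases Nat.lt_or_ge 1 t with h1 | h1
    · obtain ⟨t', rfl⟩ : ∃ t', t = t' + 1 := ⟨t - 1, by omega⟩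
      rw [hxrec i t' (by rw [Finset.mem_Icc]; omega)]
      exact norm_projBall_le_radius hR _
    · obtain rfl : t = 1 := by omega
      rw [hx1z, norm_zero]
      exact hR
  set g : Fin n → ℕ → Euc m := fun j t => sqLossGrad (h j t) (z j t) (x j t) with hg
  set p : Fin n → ℕ → Euc m :=
    fun j t => (1 / (c * s * KI ^ 2)) • hingePenaltyGrad k (x j t) with hp
  set r : Fin n → ℕ → ℝ := fun j t => hingeResidual k (x j t) / (c * √s * KI) with hr
  have hgL : ∀ j, ∀ t ∈ Finset.Icc 1 T, ‖g j t‖ ≤ L := fun j t ht =>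
    hL ▸ norm_sqLossGrad_le (hh j t ht) (hz j t ht) (hxR j t ht)
  have hpr : ∀ j t, ‖p j t‖ ≤ r j t := by
    intro j t
    rw [hp, hr]
    simp only
    rw [norm_smul, Real.norm_of_nonneg (by positivity)]
    refine (mul_le_mul_of_nonneg_left (norm_hingePenaltyGrad_le hKI.le hk _)
      (by positivity)).trans (le_of_eq ?_)
    field_simp
    rw [hss]
  have hinner : ∀ j t, ⟪x j t, p j t⟫ = c * r j t ^ 2 := by
    intro j t
    rw [hp, hr]
    simp only
    rw [inner_smul_right, inner_hingePenaltyGrad]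
    field_simp
    rw [hss, mul_comm]
  have hrec : ∀ i, ∀ t ∈ Finset.Icc 1 T, x i (t + 1) =
      projBall R (∑ j, W i j • (x j t - (η • g j t + p j t))) := by
    intro i t ht
    rw [hxrec i t ht]
    congr 1
    refine Finset.sum_congr rfl fun j _ => ?_
    rw [Finset.sum_congr rfl fun q _ => by rw [hlam j t ht q], sum_smul_hingeGrad, smul_add,
      smul_smul, hηP]
  have henergy : ∑ t ∈ Finset.Icc 1 T, ∑ j,
      (2 * η * ⟪g j t, x j t⟫ - 2 * η ^ 2 * L ^ 2 + 2 * (c - 1) * r j t ^ 2) ≤ 0 := by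
    have htel := sum_Icc_le_of_telescoping (V := fun t => ∑ j, ‖x j t‖ ^ 2)
      (a := fun t => ∑ j,
        (2 * η * ⟪g j t, x j t⟫ - 2 * η ^ 2 * L ^ 2 + 2 * (c - 1) * r j t ^ 2)) (T := T) (by
      intro t ht
      rw [← Finset.sum_sub_distrib]
      calc ∑ i, ‖x i (t + 1)‖ ^ 2
          ≤ ∑ i, ‖∑ j, W i j • (x j t - (η • g j t + p j t))‖ ^ 2 := by
            refine Finset.sum_le_sum fun i _ => ?_
            rw [hrec i t ht]
            exact pow_le_pow_left₀ (norm_nonneg _) (norm_projBall_le hR _) 2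
        _ ≤ ∑ j, ‖x j t - (η • g j t + p j t)‖ ^ 2 := hW.sum_norm_sq_le _
        _ ≤ _ := Finset.sum_le_sum fun j _ =>
            norm_sub_step_sq_le hηpos.le (hgL j t ht) (hpr j t) (hinner j t))
    refine htel.trans ?_
    have hnn : 0 ≤ ∑ j, ‖x j (T + 1)‖ ^ 2 := by positivity
    simpa [hx1z] using hnn
  have hcons : ∑ t ∈ Finset.Icc 1 T,
      ((1 - σ) * dispersion (fun i => x i t) - ∑ j, 2 * (η * L + r j t)) ≤ 0 := by
    have htel := sum_Icc_le_of_telescoping (V := fun t => dispersion fun i => x i t)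
      (a := fun t => (1 - σ) * dispersion (fun i => x i t) - ∑ j, 2 * (η * L + r j t))
      (T := T) (by
      intro t ht
      have h1 := dispersion_step hn0 hW (x := fun i => x i t) (x' := fun i => x i (t + 1))
        (e := fun i => x i (t + 1) - ∑ j, W i j • x j t) (fun i => by simp)
      rw [← hσdef] at h1
      have h2 : ∑ i, ‖x i (t + 1) - ∑ j, W i j • x j t‖ ≤ ∑ j, 2 * ‖η • g j t + p j t‖ := by
        refine hW.sum_norm_projBall_step_le hR (fun j => hxR j t ht) fun i => hrec i t ht
      have h3 : ∑ j, 2 * ‖η • g j t + p j t‖ ≤ ∑ j, 2 * (η * L + r j t) := by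
        refine Finset.sum_le_sum fun j _ => ?_
        have h4 := norm_add_le (η • g j t) (p j t)
        rw [norm_smul, Real.norm_of_nonneg hηpos.le] at h4
        have h5 := mul_le_mul_of_nonneg_left (hgL j t ht) hηpos.le
        linarith [hpr j t]
      linarith)
    refine htel.trans ?_
    have hnn : 0 ≤ dispersion fun i => x i (T + 1) := Real.sqrt_nonneg _
    have hzero : dispersion (fun i => x i 1) = 0 := by simp [dispersion, vecMean, hx1z]
    linarith
  set A : Finset (ℕ × Fin n) := Finset.Icc 1 T ×ˢ Finset.univ with hA
  have hAcard : (A.card : ℝ) = T * n := by simp [hA]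
  have hAmem : ∀ a ∈ A, a.1 ∈ Finset.Icc 1 T := fun a ha => (Finset.mem_product.mp ha).1
  have hAsum : ∀ f : ℕ → Fin n → ℝ,
      ∑ t ∈ Finset.Icc 1 T, ∑ j, f t j = ∑ a ∈ A, f a.1 a.2 := fun f =>
    (Finset.sum_product' _ _ _).symm
  have hGrad : ∑ a ∈ A, ⟪g a.2 a.1, x a.2 a.1⟫
      ≤ A.card * η * L ^ 2 - (c - 1) / η * ∑ a ∈ A, r a.2 a.1 ^ 2 := by
    rw [hAsum] at henergy
    simp only [Finset.sum_add_distrib, Finset.sum_sub_distrib, ← Finset.mul_sum,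
      Finset.sum_const, nsmul_eq_mul] at henergy
    refine le_of_mul_le_mul_left ?_ (show 0 < 2 * η by positivity)
    have hrw : 2 * η * (A.card * η * L ^ 2 - (c - 1) / η * ∑ a ∈ A, r a.2 a.1 ^ 2)
        = A.card * (2 * η ^ 2 * L ^ 2) - 2 * (c - 1) * ∑ a ∈ A, r a.2 a.1 ^ 2 := by
      field_simp
    rw [hrw]
    linarith
  have hDisp : ∑ t ∈ Finset.Icc 1 T, dispersion (fun i => x i t)
      ≤ 2 / (1 - σ) * ∑ a ∈ A, (η * L + r a.2 a.1) := by
    rw [Finset.sum_sub_distrib, ← Finset.mul_sum, hAsum, ← Finset.mul_sum] at hcons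
    rw [div_mul_eq_mul_div, le_div_iff₀ hσ1]
    linarith
  have hηT : η * T = 1 / (c * s * KI ^ 2) * (T : ℝ) ^ (1 - β) :=
    stepSize_mul_horizon hTpos hη
  refine ⟨?_, ?_⟩
  · intro i y hy
    obtain rfl : y = 0 := eq_zero_of_mem_cone_subset_closedBall hKR hy
    have hloss : ∀ t ∈ Finset.Icc 1 T, ∑ j, (sqLoss (h j t) (z j t) (x i t)
        - sqLoss (h j t) (z j t) 0)
        ≤ ∑ j, ⟪g j t, x j t⟫ + 2 * n * L * dispersion (fun i => x i t) := by
      intro t ht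
      have hj : ∀ j, sqLoss (h j t) (z j t) (x i t) - sqLoss (h j t) (z j t) 0
          ≤ ⟪g j t, x j t⟫ + 2 * L * dispersion (fun i => x i t) := by
        intro j
        have h1 := sqLoss_sub_le (hh j t ht) (hz j t ht) (hxR i t ht) (hxR j t ht)
        rw [← hL] at h1
        have h2 := sqLoss_sub_zero_le (h j t) (x j t) (z j t)
        have h3 := mul_le_mul_of_nonneg_left
          (norm_sub_le_two_mul_dispersion (fun i => x i t) i j) hL0
        linarith
      refine (Finset.sum_le_sum fun j _ => hj j).trans (le_of_eq ?_)
      rw [Finset.sum_add_distrib, Finset.sum_const, Finset.card_univ, Fintype.card_fin,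
        nsmul_eq_mul]
      ring
    have hC₃0 : 0 ≤ C₃ := by rw [hC₃]; positivity
    set a : ℝ := 4 * n / (1 - σ) with ha
    have ha0 : 0 ≤ a := by positivity
    have hreg : ∑ t ∈ Finset.Icc 1 T, ∑ j, sqLoss (h j t) (z j t) (x i t)
        - ∑ t ∈ Finset.Icc 1 T, ∑ j, sqLoss (h j t) (z j t) 0
        ≤ A.card * η * L ^ 2 * (1 + a + a ^ 2 / (4 * (c - 1))) := by
      refine le_trans ?_ (regret_constant_bound A (fun b => r b.2 b.1) hηpos hc)
      have h1 := Finset.sum_le_sum hloss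
      rw [Finset.sum_add_distrib, hAsum (fun t j => ⟪g j t, x j t⟫), ← Finset.mul_sum] at h1
      simp_rw [Finset.sum_sub_distrib] at h1
      have h2 := mul_le_mul_of_nonneg_left hDisp (show 0 ≤ 2 * n * L by positivity)
      have h3 : 2 * n * L * (2 / (1 - σ) * ∑ b ∈ A, (η * L + r b.2 b.1))
          = L * a * ∑ b ∈ A, (η * L + r b.2 b.1) := by
        rw [ha]; ring
      linarith
    have hsn : 1 ≤ √(n : ℝ) := by
      rw [Real.one_le_sqrt]
      exact_mod_cast hn
    have haE : a ≤ 2 * n * Ec := by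
      have h1 : 2 / (1 - σ) ≤ Ec := by
        have h2 : 2 / (1 - σ) ≤ 3 * √(n : ℝ) / (1 - σ) :=
          div_le_div_of_nonneg_right (by linarith) hσ1.le
        linarith
      calc a = 2 * n * (2 / (1 - σ)) := by rw [ha]; ring
        _ ≤ 2 * n * Ec := by gcongr
    have haE2 : a ^ 2 ≤ 4 * (n ^ 2 * Ec ^ 2) := by
      have h1 := pow_le_pow_left₀ ha0 haE 2
      linarith [h1, (by ring : (2 * n * Ec) ^ 2 = 4 * (n ^ 2 * Ec ^ 2))]
    refine hreg.trans ?_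
    have hEc2 : 1 + a + a ^ 2 / (4 * (c - 1))
        ≤ 1 + 2 * n * Ec + n ^ 2 * Ec ^ 2 / (c - 1) := by
      have h1 : a ^ 2 / (4 * (c - 1)) ≤ 4 * (n ^ 2 * Ec ^ 2) / (4 * (c - 1)) :=
        div_le_div_of_nonneg_right haE2 (by positivity)
      rw [mul_div_mul_left _ _ (by norm_num : (4 : ℝ) ≠ 0)] at h1
      linarith
    have h1 : A.card * η * L ^ 2 * (1 + a + a ^ 2 / (4 * (c - 1)))
        ≤ A.card * η * L ^ 2 * (1 + 2 * n * Ec + n ^ 2 * Ec ^ 2 / (c - 1)) := by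
      gcongr
    have h2 : A.card * η * L ^ 2 * (1 + 2 * n * Ec + n ^ 2 * Ec ^ 2 / (c - 1))
        = (n * L ^ 2 * (1 + 2 * n * Ec) / (c * s * KI ^ 2)
          + n ^ 3 * L ^ 2 * Ec ^ 2 / (c * (c - 1) * s * KI ^ 2)) * (T : ℝ) ^ (1 - β) := by
      calc _ = (η * T) * (n * L ^ 2 * (1 + 2 * n * Ec + n ^ 2 * Ec ^ 2 / (c - 1))) := by
            rw [hAcard]; ring
        _ = _ := by
            rw [hηT]
            field_simp
    have h3 : 0 ≤ 2 * n * L * C₃ + 2 * c * s * n * KI ^ 2 * R ^ 2 * (T : ℝ) ^ β := by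
      positivity
    linarith
  · have hgx : ∀ a ∈ A, -(L * R) ≤ ⟪g a.2 a.1, x a.2 a.1⟫ := by
      intro a ha
      have h1 := neg_le_of_abs_le (abs_real_inner_le_norm (g a.2 a.1) (x a.2 a.1))
      have h2 := mul_le_mul (hgL a.2 a.1 (hAmem a ha)) (hxR a.2 a.1 (hAmem a ha))
        (norm_nonneg _) hL0
      linarith
    have hr2 : ∑ a ∈ A, r a.2 a.1 ^ 2 ≤ A.card * ((η * L) ^ 2 + η * L * R) / (c - 1) := by
      have h1 := Finset.sum_le_sum hgx
      rw [Finset.sum_const, nsmul_eq_mul] at h1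
      rw [le_div_iff₀ hc1]
      have h2 : (c - 1) / η * ∑ a ∈ A, r a.2 a.1 ^ 2 ≤ A.card * η * L ^ 2 + A.card * (L * R) := by
        linarith
      have h3 := mul_le_mul_of_nonneg_left h2 hηpos.le
      have h4 : η * ((c - 1) / η * ∑ a ∈ A, r a.2 a.1 ^ 2)
          = (∑ a ∈ A, r a.2 a.1 ^ 2) * (c - 1) := by
        field_simp
      rw [h4] at h3
      linarith
    have hrsum := sum_le_of_sum_sq_le A (fun a => r a.2 a.1) (by positivity)
      (show 0 ≤ η * L * R by positivity) hc1 hr2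
    have hviol : ∑ t ∈ Finset.Icc 1 T, ∑ i, ∑ q, max ⟪k q, x i t⟫ 0
        ≤ c * s * KI * ∑ a ∈ A, r a.2 a.1 := by
      rw [hAsum, Finset.mul_sum]
      refine Finset.sum_le_sum fun a _ => (sum_hinge_le k _).trans (le_of_eq ?_)
      rw [hr]
      simp only
      field_simp
      rw [hss, mul_comm]
    have hfinal := violation_constant_bound hT hspos hKI hβ0 hc0 hR hL0 hη
    calc ∑ t ∈ Finset.Icc 1 T, ∑ i, ∑ q, max ⟪k q, x i t⟫ 0
        ≤ c * s * KI * (A.card / √(c - 1) * (η * L + √(η * L * R))) :=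
          hviol.trans (mul_le_mul_of_nonneg_left hrsum (by positivity))
      _ = n / √(c - 1) * (c * s * KI * (T * (η * L + √(η * L * R)))) := by
          rw [hAcard]; ring
      _ ≤ n / √(c - 1) * ((2 * c * s * KI * R + L / KI + 2 * √(c * s * L * R))
            * (T : ℝ) ^ (1 - β / 2)) :=
          mul_le_mul_of_nonneg_left hfinal (by positivity)
      _ = _ := (mul_assoc _ _ _).symm
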